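/- arXiv:2605.19778 — 4 statements merged into one kernel-verified Lean document; each statement's English description precedes it below -/
import Mathlib

section
/- Dynamic linearity of the B-cos transform: for every weight matrix W ∈ ℝ^{q×p}, every B ≥ 1, and every input x ∈ ℝ^p, the B-cos transform satisfies f_{(W,B)}(x) = W̃_{(W,B)}(x) · x, where W̃_{(W,B)}(x) is the B-cos dynamic weight matrix. Equivalently, coordinatewise: ‖ŵ_j‖·‖x‖·|c(x, ŵ_j)|^B·sgn(c(x, ŵ_j)) = |c(x, ŵ_j)|^{B−1}·⟨ŵ_j, x⟩ for every j ∈ {1,…,q}. -/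
open scoped Classical

noncomputable section BcosGNN

/-- Euclidean norm of a vector in `ℝ^p`. -/
def vnorm {p : ℕ} (x : Fin p → ℝ) : ℝ := Real.sqrt (∑ i, x i ^ 2)

/-- Euclidean inner product on `ℝ^p`. -/
def vdot {p : ℕ} (x w : Fin p → ℝ) : ℝ := ∑ i, x i * w i

/-- Cosine similarity: `⟨x,w⟩ / (‖x‖‖w‖)` if both are nonzero, `0` otherwise. -/
def cosSim {p : ℕ} (x w : Fin p → ℝ) : ℝ :=
  if x ≠ 0 ∧ w ≠ 0 then vdot x w / (vnorm x * vnorm w) else 0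

/-- Hat operator: `ŵ = w / ‖w‖` if `w ≠ 0`, else `0`. -/
def hatVec {p : ℕ} (w : Fin p → ℝ) : Fin p → ℝ :=
  if w ≠ 0 then (vnorm w)⁻¹ • w else 0

/-- The B-cos transform `f_{(W,B)} : ℝ^p → ℝ^q`, defined coordinatewise by
`f_{(W,B)}(x)_j = ‖ŵ_j‖·‖x‖·|c(x,ŵ_j)|^B·sgn(c(x,ŵ_j))` (real powers). -/
def bcos {q p : ℕ} (W : Matrix (Fin q) (Fin p) ℝ) (B : ℝ) (x : Fin p → ℝ) :
    Fin q → ℝ :=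
  fun j =>
    vnorm (hatVec (W j)) * vnorm x * |cosSim x (hatVec (W j))| ^ B *
      Real.sign (cosSim x (hatVec (W j)))

/-- The B-cos dynamic weight matrix: its `j`-th row is `|c(x,ŵ_j)|^{B-1} · ŵ_j`. -/
def bcosDynW {q p : ℕ} (W : Matrix (Fin q) (Fin p) ℝ) (B : ℝ) (x : Fin p → ℝ) :
    Matrix (Fin q) (Fin p) ℝ :=
  fun j i => |cosSim x (hatVec (W j))| ^ (B - 1) * hatVec (W j) i

theorem vnorm_eq_zero_iff {p : ℕ} (x : Fin p → ℝ) : vnorm x = 0 ↔ x = 0 := by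
  rw [vnorm, Real.sqrt_eq_zero (Finset.sum_nonneg fun i _ => sq_nonneg (x i)),
    Finset.sum_eq_zero_iff_of_nonneg fun i _ => sq_nonneg (x i)]
  simp [funext_iff]

theorem vnorm_mul_vnorm_mul_cosSim {p : ℕ} (x w : Fin p → ℝ) :
    vnorm w * vnorm x * cosSim x w = vdot w x := by
  have hcomm : vdot x w = vdot w x := Finset.sum_congr rfl fun i _ => mul_comm _ _
  by_cases hx : x = 0
  · subst hx
    simp [cosSim, vdot]
  by_cases hw : w = 0
  · subst hw
    simp [cosSim, vdot]
  have hnx : vnorm x ≠ 0 := mt (vnorm_eq_zero_iff x).mp hx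
  have hnw : vnorm w ≠ 0 := mt (vnorm_eq_zero_iff w).mp hw
  rw [cosSim, if_pos ⟨hx, hw⟩, hcomm]
  field_simp

theorem abs_rpow_mul_sign (c B : ℝ) :
    |c| ^ B * Real.sign c = |c| ^ (B - 1) * c := by
  rcases eq_or_ne c 0 with rfl | hc
  · simp
  have habs : |c| * Real.sign c = c := by
    rcases hc.lt_or_gt with h | h
    · simp [Real.sign_of_neg h, abs_of_neg h]
    · simp [Real.sign_of_pos h, abs_of_pos h]
  have hpow : |c| ^ B = |c| ^ (B - 1) * |c| := by
    rw [Real.rpow_sub_one (abs_ne_zero.mpr hc), div_mul_cancel₀ _ (abs_ne_zero.mpr hc)]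
  rw [hpow, mul_assoc, habs]

/-- **Dynamic linearity of the B-cos transform**: for every `W ∈ ℝ^{q×p}`, `B ≥ 1`
and `x ∈ ℝ^p`, `f_{(W,B)}(x) = W̃_{(W,B)}(x) · x`; equivalently, coordinatewise,
`‖ŵ_j‖·‖x‖·|c(x,ŵ_j)|^B·sgn(c(x,ŵ_j)) = |c(x,ŵ_j)|^{B-1}·⟨ŵ_j, x⟩` for every `j`. -/
theorem bcos_dynamic_linearity {q p : ℕ} (W : Matrix (Fin q) (Fin p) ℝ) (B : ℝ)
    (hB : 1 ≤ B) (x : Fin p → ℝ) :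
    bcos W B x = (bcosDynW W B x).mulVec x ∧
      ∀ j : Fin q,
        vnorm (hatVec (W j)) * vnorm x * |cosSim x (hatVec (W j))| ^ B *
            Real.sign (cosSim x (hatVec (W j))) =
          |cosSim x (hatVec (W j))| ^ (B - 1) * vdot (hatVec (W j)) x := by
  have coordinatewise : ∀ j : Fin q,
      vnorm (hatVec (W j)) * vnorm x * |cosSim x (hatVec (W j))| ^ B *
          Real.sign (cosSim x (hatVec (W j))) =
        |cosSim x (hatVec (W j))| ^ (B - 1) * vdot (hatVec (W j)) x := by
    intro j
    rw [mul_assoc, abs_rpow_mul_sign, ← vnorm_mul_vnorm_mul_cosSim]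
    ring
  refine ⟨funext fun j => (coordinatewise j).trans ?_, coordinatewise⟩
  simp only [Matrix.mulVec, dotProduct, bcosDynW, vdot, Finset.mul_sum, mul_assoc]

end BcosGNN
end

section
/- Maximal B-cos activation characterizes alignment: let W ∈ ℝ^{q×p}, B ≥ 1, j ∈ {1,…,q} with w_j ≠ 0, and x ∈ ℝ^p with x ≠ 0. Then |f_{(W,B)}(x)_j| = ‖x‖ if and only if x = λ·w_j for some nonzero scalar λ ∈ ℝ. -/
open scoped Classical

noncomputable section BcosGNN

theorem vnorm_eq_norm {p : ℕ} (x : Fin p → ℝ) : vnorm x = ‖WithLp.toLp 2 x‖ := by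
  simp [vnorm, EuclideanSpace.norm_eq]

theorem vdot_eq_inner {p : ℕ} (x w : Fin p → ℝ) :
    vdot x w = inner ℝ (WithLp.toLp 2 x) (WithLp.toLp 2 w) := by
  simp [vdot, PiLp.inner_apply, mul_comm]

theorem vnorm_pos {p : ℕ} {x : Fin p → ℝ} (hx : x ≠ 0) : 0 < vnorm x := by
  rw [vnorm_eq_norm, norm_pos_iff]
  simpa using hx

theorem hatVec_eq_smul {p : ℕ} {w : Fin p → ℝ} (hw : w ≠ 0) :
    hatVec w = (vnorm w)⁻¹ • w := if_pos hw

theorem hatVec_ne_zero {p : ℕ} {w : Fin p → ℝ} (hw : w ≠ 0) : hatVec w ≠ 0 := by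
  rw [hatVec_eq_smul hw]
  exact smul_ne_zero (inv_ne_zero (vnorm_pos hw).ne') hw

theorem vnorm_hatVec {p : ℕ} {w : Fin p → ℝ} (hw : w ≠ 0) : vnorm (hatVec w) = 1 := by
  have h := (vnorm_pos hw).ne'
  rw [hatVec_eq_smul hw, vnorm_eq_norm, WithLp.toLp_smul, norm_smul, ← vnorm_eq_norm,
    Real.norm_of_nonneg (inv_nonneg.mpr (vnorm_pos hw).le), inv_mul_cancel₀ h]

theorem abs_cosSim_eq_one_iff {p : ℕ} {x w : Fin p → ℝ} (hx : x ≠ 0) (hw : w ≠ 0) :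
    |cosSim x w| = 1 ↔ ∃ l : ℝ, l ≠ 0 ∧ x = l • w := by
  have hw' : WithLp.toLp 2 w ≠ 0 := by simpa using hw
  rw [cosSim, if_pos ⟨hx, hw⟩, vdot_eq_inner, vnorm_eq_norm, vnorm_eq_norm, real_inner_comm,
    mul_comm ‖WithLp.toLp 2 x‖, abs_real_inner_div_norm_mul_norm_eq_one_iff]
  simp only [ne_eq, hw', not_false_eq_true, true_and, ← WithLp.toLp_smul,
    (WithLp.toLp_injective 2).eq_iff]

theorem abs_bcos_apply {q p : ℕ} (W : Matrix (Fin q) (Fin p) ℝ) {B : ℝ} (hB : B ≠ 0)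
    (x : Fin p → ℝ) {j : Fin q} (hw : W j ≠ 0) :
    |bcos W B x j| = vnorm x * |cosSim x (hatVec (W j))| ^ B := by
  have hn : 0 ≤ vnorm x := Real.sqrt_nonneg _
  rw [bcos, vnorm_hatVec hw, one_mul, abs_mul, abs_mul, abs_of_nonneg hn,
    abs_of_nonneg (Real.rpow_nonneg (abs_nonneg _) B)]
  rcases lt_trichotomy (cosSim x (hatVec (W j))) 0 with h | h | h
  · simp [Real.sign_of_neg h]
  · simp [h, Real.zero_rpow hB]
  · simp [Real.sign_of_pos h]

/-- **Maximal B-cos activation characterizes alignment**: for `w_j ≠ 0` and `x ≠ 0`,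
`|f_{(W,B)}(x)_j| = ‖x‖` iff `x = λ·w_j` for some nonzero scalar `λ`. -/
theorem bcos_maximal_iff_aligned {q p : ℕ} (W : Matrix (Fin q) (Fin p) ℝ) (B : ℝ)
    (hB : 1 ≤ B) (j : Fin q) (hw : W j ≠ 0) (x : Fin p → ℝ) (hx : x ≠ 0) :
    |bcos W B x j| = vnorm x ↔ ∃ l : ℝ, l ≠ 0 ∧ x = l • W j := by
  have hB0 : B ≠ 0 := (zero_lt_one.trans_le hB).ne'
  have hv : (vnorm (W j))⁻¹ ≠ 0 := inv_ne_zero (vnorm_pos hw).ne'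
  rw [abs_bcos_apply W hB0 x hw, mul_eq_left₀ (vnorm_pos hx).ne',
    ← Real.one_rpow B, Real.rpow_left_inj (abs_nonneg _) zero_le_one hB0,
    abs_cosSim_eq_one_iff hx (hatVec_ne_zero hw),
    hatVec_eq_smul hw]
  constructor
  · rintro ⟨l, hl, h⟩
    exact ⟨l * (vnorm (W j))⁻¹, mul_ne_zero hl hv, by rw [h, smul_smul]⟩
  · rintro ⟨l, hl, h⟩
    refine ⟨l * vnorm (W j), mul_ne_zero hl (vnorm_pos hw).ne', ?_⟩
    rw [smul_smul, mul_assoc, mul_inv_cancel₀ (vnorm_pos hw).ne', mul_one, h]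

end BcosGNN
end

section
/- Degree-one homogeneity of the B-cos transform: for every weight matrix W ∈ ℝ^{q×p}, every B ≥ 1, every x ∈ ℝ^p, and every scalar λ ∈ ℝ, the B-cos transform satisfies f_{(W,B)}(λ·x) = λ·f_{(W,B)}(x). -/
open scoped Classical

noncomputable section BcosGNN

theorem vnorm_smul {p : ℕ} (l : ℝ) (x : Fin p → ℝ) : vnorm (l • x) = |l| * vnorm x := by
  simp only [vnorm, Pi.smul_apply, smul_eq_mul, mul_pow, ← Finset.mul_sum]
  rw [Real.sqrt_mul (sq_nonneg l), Real.sqrt_sq_eq_abs]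

theorem vnorm_neg {p : ℕ} (x : Fin p → ℝ) : vnorm (-x) = vnorm x := by simp [vnorm]

theorem vdot_smul_left {p : ℕ} (l : ℝ) (x w : Fin p → ℝ) :
    vdot (l • x) w = l * vdot x w := by
  simp only [vdot, Pi.smul_apply, smul_eq_mul, Finset.mul_sum, mul_assoc]

theorem cosSim_smul_left_of_pos {p : ℕ} {l : ℝ} (hl : 0 < l) (x w : Fin p → ℝ) :
    cosSim (l • x) w = cosSim x w := by
  simp only [cosSim, ne_eq, smul_eq_zero, hl.ne', false_or, vnorm_smul, vdot_smul_left,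
    abs_of_pos hl, mul_assoc, mul_div_mul_left _ _ hl.ne']

theorem cosSim_neg_left {p : ℕ} (x w : Fin p → ℝ) : cosSim (-x) w = -cosSim x w := by
  have hdot : vdot (-x) w = -vdot x w := by simp [vdot]
  by_cases h : x ≠ 0 ∧ w ≠ 0
  · simp [cosSim, h, vnorm_neg, hdot, neg_div]
  · simp only [cosSim, ne_eq, neg_eq_zero] at h ⊢
    simp only [if_neg h, neg_zero]

/-- The B-cos transform is positively homogeneous of degree one. -/
theorem bcos_smul_of_pos {q p : ℕ} (W : Matrix (Fin q) (Fin p) ℝ) (B : ℝ) {l : ℝ}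
    (hl : 0 < l) (x : Fin p → ℝ) : bcos W B (l • x) = l • bcos W B x := by
  funext j
  simp only [bcos, Pi.smul_apply, smul_eq_mul, cosSim_smul_left_of_pos hl, vnorm_smul,
    abs_of_pos hl]
  ring

/-- The B-cos transform is odd. -/
theorem bcos_neg {q p : ℕ} (W : Matrix (Fin q) (Fin p) ℝ) (B : ℝ) (x : Fin p → ℝ) :
    bcos W B (-x) = -bcos W B x := by
  funext j
  simp only [bcos, Pi.neg_apply, cosSim_neg_left, vnorm_neg, abs_neg, Real.sign_neg, mul_neg]

/-- **Degree-one homogeneity of the B-cos transform**: for every `W`, `B ≥ 1`,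
`x ∈ ℝ^p` and scalar `λ ∈ ℝ`, `f_{(W,B)}(λ·x) = λ·f_{(W,B)}(x)`. -/
theorem bcos_homogeneous {q p : ℕ} (W : Matrix (Fin q) (Fin p) ℝ) (B : ℝ)
    (hB : 1 ≤ B) (x : Fin p → ℝ) (l : ℝ) :
    bcos W B (l • x) = l • bcos W B x := by
  rcases lt_trichotomy l 0 with hl | rfl | hl
  · rw [← neg_smul_neg l x, bcos_smul_of_pos W B (neg_pos.mpr hl), bcos_neg, neg_smul_neg]
  · funext j
    simp [bcos, vnorm]
  · exact bcos_smul_of_pos W B hl x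

end BcosGNN
end

section
/- Proposition 1 (sum-aggregation message passing preserves dynamic linearity): let n, L ∈ ℕ, A ∈ ℝ^{n×n}, dimensions p_0,…,p_L and m_1,…,m_L, initial node features x_i^{(0)} ∈ ℝ^{p_0} for i = 1,…,n, and x̃ ∈ ℝ^{n p_0} their vertical stacking. For each k = 1,…,L suppose given Φ^{(k)}: ℝ^{p_{k−1}} → ℝ^{m_k} with witness W_Φ^{(k)} (Φ^{(k)}(y) = W_Φ^{(k)}(y)·y for all y) and Ψ^{(k)}: ℝ^{p_{k−1}} × ℝ^{m_k} → ℝ^{p_k} with witness W_Ψ^{(k)}: ℝ^{p_{k−1}} × ℝ^{m_k} → ℝ^{p_k × (p_{k−1}+m_k)} (Ψ^{(k)}(u,v) = W_Ψ^{(k)}(u,v)·(u;v) for all u, v, where (u;v) is vertical concatenation). Define node embeddings recursively by z_i^{(k)} = Σ_{j=1}^n A_{ij}·Φ^{(k)}(x_j^{(k−1)}) and x_i^{(k)} = Ψ^{(k)}(x_i^{(k−1)}, z_i^{(k)}). Define matrices W_i^{(k)} ∈ ℝ^{p_k × n p_0} recursively by W_i^{(0)} = E_i (the block-selector matrix with E_i·x̃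 = x_i^{(0)}) and W_i^{(k)} = W_Ψ^{(k)}(x_i^{(k−1)}, z_i^{(k)}) · [W_i^{(k−1)} ; Σ_{j=1}^n A_{ij}·W_Φ^{(k)}(x_j^{(k−1)})·W_j^{(k−1)}], where [·;·] denotes vertical block concatenation. Then x_i^{(k)} = W_i^{(k)}·x̃ for every node i ∈ {1,…,n} and every k ∈ {0,…,L}. -/
open scoped Classical

noncomputable section

/-- Node embeddings of a sum-aggregation message-passing GNN:
`x_i^{(0)}` are the initial features, `z_i^{(k+1)} = Σ_j A_{ij}·Φ^{(k+1)}(x_j^{(k)})`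
and `x_i^{(k+1)} = Ψ^{(k+1)}(x_i^{(k)}, z_i^{(k+1)})` (here 0-indexed in `k`). -/
def gnnEmb {n : ℕ} (p m : ℕ → ℕ) (A : Matrix (Fin n) (Fin n) ℝ)
    (x0 : Fin n → Fin (p 0) → ℝ)
    (Φ : ∀ k, (Fin (p k) → ℝ) → (Fin (m k) → ℝ))
    (Ψ : ∀ k, (Fin (p k) → ℝ) → (Fin (m k) → ℝ) → (Fin (p (k + 1)) → ℝ)) :
    ∀ k, Fin n → Fin (p k) → ℝ
  | 0 => x0
  | k + 1 => fun i =>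
      Ψ k (gnnEmb p m A x0 Φ Ψ k i)
        (∑ j, A i j • Φ k (gnnEmb p m A x0 Φ Ψ k j))

/-- The dynamic weight matrices `W_i^{(k)}` of Proposition 1: `W_i^{(0)} = E_i` is the
block-selector matrix, and
`W_i^{(k+1)} = W_Ψ^{(k+1)}(x_i^{(k)}, z_i^{(k+1)}) ·
  [W_i^{(k)} ; Σ_j A_{ij}·W_Φ^{(k+1)}(x_j^{(k)})·W_j^{(k)}]`,
where `[·;·]` is vertical block concatenation. -/
def gnnW {n : ℕ} (p m : ℕ → ℕ) (A : Matrix (Fin n) (Fin n) ℝ)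
    (x0 : Fin n → Fin (p 0) → ℝ)
    (Φ : ∀ k, (Fin (p k) → ℝ) → (Fin (m k) → ℝ))
    (Ψ : ∀ k, (Fin (p k) → ℝ) → (Fin (m k) → ℝ) → (Fin (p (k + 1)) → ℝ))
    (WΦ : ∀ k, (Fin (p k) → ℝ) → Matrix (Fin (m k)) (Fin (p k)) ℝ)
    (WΨ : ∀ k, (Fin (p k) → ℝ) → (Fin (m k) → ℝ) →
      Matrix (Fin (p (k + 1))) (Fin (p k) ⊕ Fin (m k)) ℝ) :
    ∀ k, Fin n → Matrix (Fin (p k)) (Fin n × Fin (p 0)) ℝ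
  | 0 => fun i => Matrix.of fun a jb => if jb.1 = i ∧ jb.2 = a then 1 else 0
  | k + 1 => fun i =>
      WΨ k (gnnEmb p m A x0 Φ Ψ k i)
          (∑ j, A i j • Φ k (gnnEmb p m A x0 Φ Ψ k j)) *
        Matrix.fromRows (gnnW p m A x0 Φ Ψ WΦ WΨ k i)
          (∑ j, A i j •
            (WΦ k (gnnEmb p m A x0 Φ Ψ k j) * gnnW p m A x0 Φ Ψ WΦ WΨ k j))

/-- **Proposition 1 (sum-aggregation message passing preserves dynamic linearity)**:
if every message function `Φ^{(k)}` and update function `Ψ^{(k)}` satisfies dynamic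
linearity (with witnesses `W_Φ^{(k)}`, `W_Ψ^{(k)}`), and aggregation is weighted
summation with weights `A`, then the node embeddings satisfy
`x_i^{(k)} = W_i^{(k)}·x̃` for every node `i` and every depth `k`, where `x̃` is the
vertical stacking of the initial node features. -/
theorem gnn_dynamic_linearity {n : ℕ} (p m : ℕ → ℕ)
    (A : Matrix (Fin n) (Fin n) ℝ) (x0 : Fin n → Fin (p 0) → ℝ)
    (Φ : ∀ k, (Fin (p k) → ℝ) → (Fin (m k) → ℝ))
    (Ψ : ∀ k, (Fin (p k) → ℝ) → (Fin (m k) → ℝ) → (Fin (p (k + 1)) → ℝ))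
    (WΦ : ∀ k, (Fin (p k) → ℝ) → Matrix (Fin (m k)) (Fin (p k)) ℝ)
    (WΨ : ∀ k, (Fin (p k) → ℝ) → (Fin (m k) → ℝ) →
      Matrix (Fin (p (k + 1))) (Fin (p k) ⊕ Fin (m k)) ℝ)
    (hΦ : ∀ k y, Φ k y = (WΦ k y).mulVec y)
    (hΨ : ∀ k u v, Ψ k u v = (WΨ k u v).mulVec (Sum.elim u v))
    (L : ℕ) :
    ∀ k ≤ L, ∀ i : Fin n,
      gnnEmb p m A x0 Φ Ψ k i =
        (gnnW p m A x0 Φ Ψ WΦ WΨ k i).mulVec (fun jb => x0 jb.1 jb.2) := by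
  have key : ∀ k, ∀ i : Fin n,
      gnnEmb p m A x0 Φ Ψ k i =
        (gnnW p m A x0 Φ Ψ WΦ WΨ k i).mulVec (fun jb => x0 jb.1 jb.2) := by
    intro k
    induction k with
    | zero =>
      intro i
      ext a
      have hsel : ∀ jb : Fin n × Fin (p 0), (jb.1 = i ∧ jb.2 = a) ↔ jb = (i, a) :=
        fun jb => (Prod.ext_iff (x := jb) (y := (i, a))).symm
      simp [gnnEmb, gnnW, Matrix.mulVec, dotProduct, hsel]
    | succ k ih =>
      intro i
      rw [gnnEmb, gnnW]
      beta_reduce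
      rw [hΨ, ← Matrix.mulVec_mulVec, Matrix.fromRows_mulVec, ← ih i,
        Matrix.sum_mulVec]
      simp only [Matrix.smul_mulVec, ← Matrix.mulVec_mulVec, ← ih, hΦ]
  exact fun k _ => key k

end
end
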